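/- (Two-sided weighted Grönwall estimates for the scalar field near the singularity.) Let q̃ ∈ D and let J := {(u,v) ∈ D : u ≤ u_{q̃}, v ≤ v_{q̃}, 0 < r(u,v) ≤ r₀}, with ∂_u r < 0 and ∂_v r < 0 on J, and suppose every point of J is connected to the level set {r = r₀} through J by the foliation of level sets L_s = {r = s}, s ∈ (0, r₀]. Assume the wave equation r ∂_u∂_v φ = −∂_u r ∂_v φ − ∂_v r ∂_u φ holds on J, and that there are constants C₁, C₂ > 0 and H ≥ 0 with ∫₀^{r₀} H s^{1/8 − 1} ds ≤ log 2 such that |(C₁ ∂_v r)/(C₂ ∂_u r) − 1| ≤ H r^{1/8} and |(C₂ ∂_u r)/(C₁ ∂_v r) − 1| ≤ H r^{1/8} on J. Define Ψ̃(r₀) as the supremum over {r = r₀} ∩ J of max(|C₂ r ∂_u φ|, |C₁ r ∂_v φ|). Then for all (u,v) ∈ J: C₁ r² |∂_v φ|(u,v) ≤ 2 r₀ Ψ̃(r₀) and C₂ r² |∂_u φ|(u,v) ≤ 2 r₀ Ψ̃(r₀). If moreover ∂_u φ > 0 and ∂_v φ > 0 on J, and Ψ(r₀) denotes the infimum over {r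 = r₀} ∩ J of min(C₂ r ∂_u φ, C₁ r ∂_v φ), then also C₁ r² ∂_v φ(u,v) ≥ r₀ Ψ(r₀)/2 and C₂ r² ∂_u φ(u,v) ≥ r₀ Ψ(r₀)/2 for all (u,v) ∈ J. -/

import Mathlib

open Real Filter Set

/-- Partial derivative in the first (u) coordinate. -/
noncomputable def pdu (f : ℝ × ℝ → ℝ) (z : ℝ × ℝ) : ℝ :=
  deriv (fun x => f (x, z.2)) z.1

/-- Partial derivative in the second (v) coordinate. -/
noncomputable def pdv (f : ℝ × ℝ → ℝ) (z : ℝ × ℝ) : ℝ :=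
  deriv (fun y => f (z.1, y)) z.2

/-- A region of the `(u,v)`-plane below a corner point on which `r ≤ r₀` decreases along both
null directions, and in which every point is joined to `{r = r₀}` by past null segments. -/
structure PastConnected (J : Set (ℝ × ℝ)) (r : ℝ × ℝ → ℝ) (q : ℝ × ℝ) (r₀ : ℝ) : Prop where
  le_top : ∀ p ∈ J, r p ≤ r₀
  le_corner : ∀ p ∈ J, p.1 ≤ q.1 ∧ p.2 ≤ q.2
  eventually_mem : ∀ p ∈ J, r p < r₀ → ∀ᶠ z in nhds p, z.1 ≤ q.1 → z.2 ≤ q.2 → z ∈ J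
  strictAnti_fst : ∀ v a b, a < b → (∀ x ∈ Icc a b, (x, v) ∈ J) → r (b, v) < r (a, v)
  strictAnti_snd : ∀ u a b, a < b → (∀ y ∈ Icc a b, (u, y) ∈ J) → r (u, b) < r (u, a)
  exists_fst : ∀ z ∈ J, ∃ a ≤ z.1, r (a, z.2) = r₀ ∧ ∀ t ∈ Icc a z.1, (t, z.2) ∈ J
  exists_snd : ∀ z ∈ J, ∃ a ≤ z.2, r (z.1, a) = r₀ ∧ ∀ t ∈ Icc a z.2, (z.1, t) ∈ J

namespace PastConnected

variable {J : Set (ℝ × ℝ)} {r : ℝ × ℝ → ℝ} {q : ℝ × ℝ} {r₀ : ℝ}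

theorem swap (h : PastConnected J r q r₀) :
    PastConnected (Prod.swap ⁻¹' J) (r ∘ Prod.swap) q.swap r₀ where
  le_top p hp := h.le_top _ hp
  le_corner p hp := (h.le_corner _ hp).symm
  eventually_mem p hp hlt := by
    filter_upwards [continuous_swap.continuousAt.eventually (h.eventually_mem _ hp hlt)]
      with z hz h1 h2 using hz h2 h1
  strictAnti_fst := h.strictAnti_snd
  strictAnti_snd := h.strictAnti_fst
  exists_fst z hz := h.exists_snd _ hz
  exists_snd z hz := h.exists_fst _ hz

theorem mem_left_of_forall (h : PastConnected J r q r₀) {t U w : ℝ} (htU : t ≤ U)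
    (hmem : ∀ x, x ≤ U → (t < x ∨ x = U) → (x, w) ∈ J) : (t, w) ∈ J := by
  obtain ⟨a, haU, har, hseg⟩ := h.exists_fst (U, w) (hmem U le_rfl (Or.inr rfl))
  by_cases hat : a ≤ t
  · exact hseg t ⟨hat, htU⟩
  · push Not at hat
    have h1 : (t + a) / 2 < a := by linarith
    have h2 : t < (t + a) / 2 := by linarith
    have h3 := h.strictAnti_fst w _ _ h1 fun x hx =>
      hmem x (hx.2.trans haU) (Or.inl (h2.trans_le hx.1))
    have h4 := h.le_top _ (hmem ((t + a) / 2) (h1.le.trans haU) (Or.inl h2))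
    simp only at har
    linarith

theorem mem_down_of_forall (h : PastConnected J r q r₀) {t V w : ℝ} (hwV : w ≤ V)
    (hmem : ∀ y, y ≤ V → (w < y ∨ y = V) → (t, y) ∈ J) : (t, w) ∈ J :=
  h.swap.mem_left_of_forall hwV hmem

theorem le_of_segment_fst (h : PastConnected J r q r₀) {a t U v : ℝ} (haU : a ≤ U)
    (har : r (a, v) = r₀) (hseg : ∀ x ∈ Icc t U, (x, v) ∈ J) (htU : t ≤ U) : a ≤ t := by
  by_contra! hlt
  have h1 := h.strictAnti_fst v t a hlt fun x hx => hseg x ⟨hx.1, hx.2.trans haU⟩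
  have h2 := h.le_top _ (hseg t ⟨le_rfl, htU⟩)
  linarith

theorem rectangle_subset_left (h : PastConnected J r q r₀) {a t U w V : ℝ} (htU : t ≤ U)
    (hrect : Icc t U ×ˢ Icc w V ⊆ J) (hat : a ≤ t) (har : r (a, w) = r₀)
    (hseg : ∀ x ∈ Icc a t, (x, w) ∈ J) : Icc a U ×ˢ Icc w V ⊆ J := by
  set S : Set ℝ := {x | Icc x U ×ˢ Icc w V ⊆ J} with hS
  suffices Icc a t ⊆ S from this ⟨le_rfl, hat⟩
  refine IsClosed.Icc_subset_of_forall_exists_lt ?_ hrect ?_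
  · refine isClosed_of_closure_subset fun x hx => ?_
    have hx' : x ∈ Icc a t :=
      closure_minimal inter_subset_right isClosed_Icc hx
    refine ⟨?_, hx'⟩
    rintro ⟨y, w'⟩ ⟨hy, hw'⟩
    refine h.mem_left_of_forall hy.2 fun y' hy'U hy' => ?_
    rcases hy' with hlt | rfl
    · obtain ⟨x', hx'y, hx'S, -⟩ := mem_closure_iff.1 hx (Iio y') isOpen_Iio (hy.1.trans_lt hlt)
      exact hx'S ⟨⟨le_of_lt hx'y, hy'U⟩, hw'⟩
    · exact hrect ⟨⟨htU, le_rfl⟩, hw'⟩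
  · rintro x ⟨hxS, hax, hxt⟩ y hyx
    have hxU := hxt.trans htU
    have hxw : r (x, w) < r₀ := har ▸ h.strictAnti_fst w a x hax fun x' hx' =>
      hseg x' ⟨hx'.1, hx'.2.trans hxt⟩
    have hev : ∀ᶠ x' in nhds x, ∀ w' ∈ Icc w V, x' ≤ q.1 → w' ≤ q.2 → (x', w') ∈ J := by
      refine isCompact_Icc.eventually_forall_of_forall_eventually fun w' hw' => ?_
      have hxw' : (x, w') ∈ J := hxS ⟨⟨le_rfl, hxU⟩, hw'⟩
      refine h.eventually_mem _ hxw' ?_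
      rcases hw'.1.eq_or_lt with rfl | hlt
      · exact hxw
      · exact (h.strictAnti_snd x w w' hlt fun y' hy' =>
          hxS ⟨⟨le_rfl, hxU⟩, hy'.1, hy'.2.trans hw'.2⟩).trans hxw
    obtain ⟨ε, hε, hball⟩ := Metric.eventually_nhds_iff.1 hev
    refine ⟨max y (x - ε / 2), ?_, le_max_left _ _, max_lt hyx (by linarith)⟩
    rintro ⟨x', w'⟩ ⟨hx', hw'⟩
    by_cases hxx' : x ≤ x'
    · exact hxS ⟨⟨hxx', hx'.2⟩, hw'⟩
    · push Not at hxx'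
      have hc := h.le_corner _ (hxS ⟨⟨le_rfl, hxU⟩, hw'⟩ : (x, w') ∈ J)
      have := (le_max_right _ _).trans hx'.1
      refine hball ?_ w' hw' (hxx'.le.trans hc.1) hc.2
      rw [Real.dist_eq, abs_lt]
      constructor <;> linarith

theorem rectangle_subset_down (h : PastConnected J r q r₀) {b t U w V : ℝ} (hwV : w ≤ V)
    (hrect : Icc t U ×ˢ Icc w V ⊆ J) (hbw : b ≤ w) (hbr : r (t, b) = r₀)
    (hseg : ∀ y ∈ Icc b w, (t, y) ∈ J) : Icc t U ×ˢ Icc b V ⊆ J := by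
  have := h.swap.rectangle_subset_left hwV (fun p hp => hrect ⟨hp.2, hp.1⟩) hbw hbr hseg
  exact fun p hp => this (show p.swap ∈ _ from ⟨hp.2, hp.1⟩)

/-- The set of points whose future rectangle up to `z` lies in `J` is compact. -/
theorem isCompact_past (h : PastConnected J r q r₀) {z : ℝ × ℝ} (hz : z ∈ J) :
    IsCompact {p : ℝ × ℝ | p.1 ≤ z.1 ∧ p.2 ≤ z.2 ∧ Icc p.1 z.1 ×ˢ Icc p.2 z.2 ⊆ J} := by
  obtain ⟨a, haz, har, -⟩ := h.exists_fst z hz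
  obtain ⟨b, hbz, hbr, -⟩ := h.exists_snd z hz
  refine (isCompact_Icc (a := a) (b := z.1)).prod (isCompact_Icc (a := b) (b := z.2))
    |>.of_isClosed_subset ?_ ?_
  · refine isClosed_of_closure_subset fun p hp => ?_
    have hp1 : p.1 ≤ z.1 := closure_minimal (fun x hx => hx.1)
      (isClosed_le continuous_fst continuous_const) hp
    have hp2 : p.2 ≤ z.2 := closure_minimal (fun x hx => hx.2.1)
      (isClosed_le continuous_snd continuous_const) hp
    refine ⟨hp1, hp2, ?_⟩
    rintro ⟨x, y⟩ ⟨hx, hy⟩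
    refine h.mem_left_of_forall hx.2 fun x' hx'z hx' => ?_
    refine h.mem_down_of_forall hy.2 fun y' hy'z hy' => ?_
    rw [mem_closure_iff_nhdsWithin_neBot] at hp
    have e1 : ∀ᶠ k in nhdsWithin p
        {p : ℝ × ℝ | p.1 ≤ z.1 ∧ p.2 ≤ z.2 ∧ Icc p.1 z.1 ×ˢ Icc p.2 z.2 ⊆ J}, k.1 ≤ x' := by
      rcases hx' with hlt | rfl
      · exact mem_nhdsWithin_of_mem_nhds
          ((continuous_fst.continuousAt.eventually_lt continuousAt_const
            (hx.1.trans_lt hlt)).mono fun _ => le_of_lt)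
      · exact eventually_mem_nhdsWithin.mono fun _ hk => hk.1
    have e2 : ∀ᶠ k in nhdsWithin p
        {p : ℝ × ℝ | p.1 ≤ z.1 ∧ p.2 ≤ z.2 ∧ Icc p.1 z.1 ×ˢ Icc p.2 z.2 ⊆ J}, k.2 ≤ y' := by
      rcases hy' with hlt | rfl
      · exact mem_nhdsWithin_of_mem_nhds
          ((continuous_snd.continuousAt.eventually_lt continuousAt_const
            (hy.1.trans_lt hlt)).mono fun _ => le_of_lt)
      · exact eventually_mem_nhdsWithin.mono fun _ hk => hk.2.1
    obtain ⟨k, hk1, hk2, hk⟩ := (e1.and (e2.and eventually_mem_nhdsWithin)).exists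
    exact hk.2.2 ⟨⟨hk1, hx'z⟩, hk2, hy'z⟩
  · rintro p ⟨hp1, hp2, hp⟩
    exact ⟨⟨h.le_of_segment_fst haz har (fun x hx => hp ⟨hx, hp2, le_rfl⟩) hp1, hp1⟩,
      h.swap.le_of_segment_fst hbz hbr (fun y hy => hp ⟨⟨hp1, le_rfl⟩, hy⟩) hp2, hp2⟩

/-- Continuous induction on `r`, downwards from the level set `{r = r₀}`. -/
theorem forall_pos (h : PastConnected J r q r₀) (hr : ContinuousOn r J) {f g : ℝ × ℝ → ℝ}
    (hf : ContinuousOn f J) (hg : ContinuousOn g J)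
    (hstep_snd : ∀ t b c, b ≤ c → r (t, b) = r₀ → (∀ y ∈ Icc b c, (t, y) ∈ J) →
      (∀ y ∈ Ioo b c, 0 < f (t, y) ∧ 0 < g (t, y)) → 0 < f (t, c))
    (hstep_fst : ∀ w a c, a ≤ c → r (a, w) = r₀ → (∀ x ∈ Icc a c, (x, w) ∈ J) →
      (∀ x ∈ Ioo a c, 0 < f (x, w) ∧ 0 < g (x, w)) → 0 < g (c, w)) :
    ∀ z ∈ J, 0 < f z ∧ 0 < g z := by
  intro z hz
  by_contra hcon
  set K := {p : ℝ × ℝ | p.1 ≤ z.1 ∧ p.2 ≤ z.2 ∧ Icc p.1 z.1 ×ˢ Icc p.2 z.2 ⊆ J} with hK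
  have hKJ : K ⊆ J := fun p hp => hp.2.2 ⟨⟨le_rfl, hp.1⟩, le_rfl, hp.2.1⟩
  have hKc : IsCompact K := h.isCompact_past hz
  have hmin : ContinuousOn (fun p => min (f p) (g p)) K :=
    continuous_min.comp_continuousOn ((hf.mono hKJ).prodMk (hg.mono hKJ))
  have hbad : ∀ p, p ∈ K ∩ (fun p => min (f p) (g p)) ⁻¹' Iic 0 ↔
      p ∈ K ∧ ¬ (0 < f p ∧ 0 < g p) := by
    intro p
    rw [← lt_min_iff, not_lt]
    rfl
  have hBc : IsCompact (K ∩ (fun p => min (f p) (g p)) ⁻¹' Iic 0) :=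
    hKc.of_isClosed_subset (hmin.preimage_isClosed_of_isClosed hKc.isClosed isClosed_Iic)
      inter_subset_left
  have hzK : z ∈ K := by
    refine ⟨le_rfl, le_rfl, ?_⟩
    rintro ⟨x, y⟩ ⟨hx, hy⟩
    obtain rfl : x = z.1 := le_antisymm hx.2 hx.1
    obtain rfl : y = z.2 := le_antisymm hy.2 hy.1
    exact hz
  obtain ⟨⟨t, w⟩, hpB, hpmax⟩ := hBc.exists_isMaxOn ⟨z, (hbad z).2 ⟨hzK, hcon⟩⟩
    (hr.mono (inter_subset_left.trans hKJ))
  obtain ⟨hpK, hp⟩ := (hbad _).1 hpB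
  have hgood : ∀ k ∈ K, r (t, w) < r k → 0 < f k ∧ 0 < g k := by
    intro k hk hlt
    by_contra hk'
    exact absurd (hpmax ((hbad k).2 ⟨hk, hk'⟩)) (not_le.2 hlt)
  obtain ⟨b, hbw, hbr, hbseg⟩ := h.exists_snd _ (hKJ hpK)
  obtain ⟨a, hat, har, haseg⟩ := h.exists_fst _ (hKJ hpK)
  have hdown := h.rectangle_subset_down hpK.2.1 hpK.2.2 hbw hbr hbseg
  have hleft := h.rectangle_subset_left hpK.1 hpK.2.2 hat har haseg
  refine hp ⟨hstep_snd t b w hbw hbr hbseg fun y hy => hgood _ ?_ ?_,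
    hstep_fst w a t hat har haseg fun x hx => hgood _ ?_ ?_⟩
  · exact ⟨hpK.1, hy.2.le.trans hpK.2.1, fun p hp' => hdown ⟨hp'.1, hy.1.le.trans hp'.2.1, hp'.2.2⟩⟩
  · exact h.strictAnti_snd t y w hy.2 fun y' hy' => hbseg y' ⟨hy.1.le.trans hy'.1, hy'.2⟩
  · exact ⟨hx.2.le.trans hpK.1, hpK.2.1, fun p hp' => hleft ⟨⟨hx.1.le.trans hp'.1.1, hp'.1.2⟩, hp'.2⟩⟩
  · exact h.strictAnti_fst w x t hx.2 fun x' hx' => haseg x' ⟨hx.1.le.trans hx'.1, hx'.2⟩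

end PastConnected

/-- The solution of `W' = -(1 + κ s^(1/8)) W / s` with `W(r₀) = 1`. -/
noncomputable def gronwallWeight (κ r₀ s : ℝ) : ℝ :=
  r₀ / s * Real.exp (8 * κ * (r₀ ^ ((1 : ℝ) / 8) - s ^ ((1 : ℝ) / 8)))

theorem gronwallWeight_self (κ : ℝ) {r₀ : ℝ} (hr₀ : 0 < r₀) : gronwallWeight κ r₀ r₀ = 1 := by
  simp [gronwallWeight, hr₀.ne']

theorem gronwallWeight_pos (κ : ℝ) {r₀ s : ℝ} (hr₀ : 0 < r₀) (hs : 0 < s) :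
    0 < gronwallWeight κ r₀ s := by
  unfold gronwallWeight; positivity

theorem hasDerivAt_gronwallWeight (κ r₀ : ℝ) {s : ℝ} (hs : 0 < s) :
    HasDerivAt (gronwallWeight κ r₀)
      (-(1 + κ * s ^ ((1 : ℝ) / 8)) / s * gronwallWeight κ r₀ s) s := by
  have h1 : HasDerivAt (fun s : ℝ => r₀ / s) (-r₀ / s ^ 2) s := by
    simpa [div_eq_mul_inv] using (hasDerivAt_inv hs.ne').const_mul r₀
  have h2 : HasDerivAt (fun s : ℝ => s ^ ((1 : ℝ) / 8)) (1 / 8 * s ^ ((1 : ℝ) / 8 - 1)) s :=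
    Real.hasDerivAt_rpow_const (Or.inl hs.ne')
  have h3 := h1.mul (((h2.const_sub (r₀ ^ ((1 : ℝ) / 8))).const_mul (8 * κ)).exp)
  refine h3.congr_deriv ?_
  rw [Real.rpow_sub_one hs.ne']
  unfold gronwallWeight
  field_simp
  ring

theorem continuousOn_gronwallWeight (κ r₀ : ℝ) : ContinuousOn (gronwallWeight κ r₀) (Ioi 0) :=
  fun _ hs => (hasDerivAt_gronwallWeight κ r₀ hs).continuousAt.continuousWithinAt

theorem gronwallWeight_le {κ r₀ s : ℝ} (hr₀ : 0 < r₀) (hs : 0 < s) (hκ : 0 ≤ κ)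
    (hlog : 8 * κ * r₀ ^ ((1 : ℝ) / 8) ≤ Real.log 2) :
    gronwallWeight κ r₀ s ≤ 2 * r₀ / s := by
  have hp : 0 ≤ 8 * κ * s ^ ((1 : ℝ) / 8) := by positivity
  have : Real.exp (8 * κ * (r₀ ^ ((1 : ℝ) / 8) - s ^ ((1 : ℝ) / 8))) ≤ 2 := by
    rw [← Real.le_log_iff_exp_le two_pos]
    linarith
  calc gronwallWeight κ r₀ s ≤ r₀ / s * 2 := by unfold gronwallWeight; gcongr
    _ = 2 * r₀ / s := by ring

theorem le_gronwallWeight_neg {κ r₀ s : ℝ} (hr₀ : 0 < r₀) (hs : 0 < s) (hκ : 0 ≤ κ)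
    (hlog : 8 * κ * r₀ ^ ((1 : ℝ) / 8) ≤ Real.log 2) :
    r₀ / (2 * s) ≤ gronwallWeight (-κ) r₀ s := by
  have hp : 0 ≤ 8 * κ * s ^ ((1 : ℝ) / 8) := by positivity
  have : 1 / 2 ≤ Real.exp (8 * -κ * (r₀ ^ ((1 : ℝ) / 8) - s ^ ((1 : ℝ) / 8))) := by
    rw [← Real.log_le_iff_le_exp (by norm_num), one_div, Real.log_inv]
    linarith
  calc r₀ / (2 * s) = r₀ / s * (1 / 2) := by field_simp
    _ ≤ gronwallWeight (-κ) r₀ s := by unfold gronwallWeight; gcongr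

theorem pos_of_deriv_nonneg {g g' : ℝ → ℝ} {b c : ℝ} (hbc : b ≤ c)
    (hg : ∀ x ∈ Icc b c, HasDerivAt g (g' x) x) (hg' : ∀ x ∈ Ioo b c, 0 ≤ g' x)
    (hb : 0 < g b) : 0 < g c := by
  refine hb.trans_le (monotoneOn_of_deriv_nonneg (convex_Icc b c)
    (fun x hx => (hg x hx).continuousAt.continuousWithinAt)
    (fun x hx => (hg x (interior_subset hx)).differentiableAt.differentiableWithinAt)
    (fun x hx => ?_) ⟨le_rfl, hbc⟩ ⟨hbc, le_rfl⟩ hbc)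
  rw [(hg x (interior_subset hx)).deriv]
  rw [interior_Icc] at hx
  exact hg' x hx

section Comparison

variable {ρ ρ' f R Y : ℝ → ℝ} {A H r₀ b c : ℝ}

theorem hasDerivAt_const_mul_gronwallWeight_comp (κ : ℝ) {x : ℝ} (hρ : 0 < ρ x)
    (dρ : HasDerivAt ρ (ρ' x) x) :
    HasDerivAt (fun x => A * gronwallWeight κ r₀ (ρ x))
      (-ρ' x / ρ x * ((1 + κ * ρ x ^ ((1 : ℝ) / 8)) * (A * gronwallWeight κ r₀ (ρ x)))) x := by
  refine (((hasDerivAt_gronwallWeight κ r₀ hρ).comp x dρ).const_mul A).congr_deriv ?_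
  ring

theorem lt_gronwallWeight_of_hasDerivAt (hbc : b ≤ c)
    (hρ : ∀ x ∈ Icc b c, 0 < ρ x) (hρ' : ∀ x ∈ Icc b c, ρ' x < 0)
    (dρ : ∀ x ∈ Icc b c, HasDerivAt ρ (ρ' x) x)
    (df : ∀ x ∈ Icc b c, HasDerivAt f (-ρ' x / ρ x * (R x * Y x)) x)
    (hR : ∀ x ∈ Icc b c, |R x - 1| ≤ H * ρ x ^ ((1 : ℝ) / 8))
    (hY : ∀ x ∈ Ioo b c, |Y x| < A * gronwallWeight H r₀ (ρ x))
    (hb : f b < A * gronwallWeight H r₀ (ρ b)) : f c < A * gronwallWeight H r₀ (ρ c) := by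
  refine sub_pos.1 (pos_of_deriv_nonneg (g := fun x => A * gronwallWeight H r₀ (ρ x) - f x) hbc
    (fun x hx => (hasDerivAt_const_mul_gronwallWeight_comp H (hρ x hx) (dρ x hx)).sub (df x hx))
    (fun x hx => ?_) (sub_pos.2 hb))
  have hx' := Ioo_subset_Icc_self hx
  rw [← mul_sub]
  refine mul_nonneg (div_nonneg (by linarith [hρ' x hx']) (hρ x hx').le) (sub_nonneg.2 ?_)
  have h1 : |R x| ≤ 1 + H * ρ x ^ ((1 : ℝ) / 8) := by
    have := abs_add_le (R x - 1) 1
    rw [sub_add_cancel, abs_one] at this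
    linarith [hR x hx']
  calc R x * Y x ≤ |R x| * |Y x| := by rw [← abs_mul]; exact le_abs_self _
    _ ≤ _ := mul_le_mul h1 (hY x hx).le (abs_nonneg _) ((abs_nonneg _).trans h1)

theorem abs_lt_gronwallWeight_of_hasDerivAt (hbc : b ≤ c)
    (hρ : ∀ x ∈ Icc b c, 0 < ρ x) (hρ' : ∀ x ∈ Icc b c, ρ' x < 0)
    (dρ : ∀ x ∈ Icc b c, HasDerivAt ρ (ρ' x) x)
    (df : ∀ x ∈ Icc b c, HasDerivAt f (-ρ' x / ρ x * (R x * Y x)) x)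
    (hR : ∀ x ∈ Icc b c, |R x - 1| ≤ H * ρ x ^ ((1 : ℝ) / 8))
    (hY : ∀ x ∈ Ioo b c, |Y x| < A * gronwallWeight H r₀ (ρ x))
    (hb : |f b| < A * gronwallWeight H r₀ (ρ b)) : |f c| < A * gronwallWeight H r₀ (ρ c) := by
  rw [abs_lt] at hb
  have h1 := lt_gronwallWeight_of_hasDerivAt hbc hρ hρ' dρ df hR hY hb.2
  have h2 := lt_gronwallWeight_of_hasDerivAt (f := fun x => -f x) (Y := fun x => -Y x) (A := A)
    hbc hρ hρ' dρ (fun x hx => (df x hx).neg.congr_deriv (by ring)) hR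
    (fun x hx => by rw [abs_neg]; exact hY x hx) (by linarith)
  exact abs_lt.2 ⟨by linarith, h1⟩

theorem gronwallWeight_lt_of_hasDerivAt (hbc : b ≤ c) (hr₀ : 0 < r₀) (hA : 0 ≤ A)
    (hρ : ∀ x ∈ Icc b c, 0 < ρ x) (hρ' : ∀ x ∈ Icc b c, ρ' x < 0)
    (dρ : ∀ x ∈ Icc b c, HasDerivAt ρ (ρ' x) x)
    (df : ∀ x ∈ Icc b c, HasDerivAt f (-ρ' x / ρ x * (R x * Y x)) x)
    (hR : ∀ x ∈ Icc b c, |R x - 1| ≤ H * ρ x ^ ((1 : ℝ) / 8))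
    (hR_pos : ∀ x ∈ Icc b c, 0 < R x)
    (hY : ∀ x ∈ Ioo b c, A * gronwallWeight (-H) r₀ (ρ x) < Y x)
    (hb : A * gronwallWeight (-H) r₀ (ρ b) < f b) : A * gronwallWeight (-H) r₀ (ρ c) < f c := by
  refine sub_pos.1 (pos_of_deriv_nonneg (g := fun x => f x - A * gronwallWeight (-H) r₀ (ρ x)) hbc
    (fun x hx => (df x hx).sub (hasDerivAt_const_mul_gronwallWeight_comp (-H) (hρ x hx) (dρ x hx)))
    (fun x hx => ?_) (sub_pos.2 hb))
  have hx' := Ioo_subset_Icc_self hx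
  rw [← mul_sub]
  refine mul_nonneg (div_nonneg (by linarith [hρ' x hx']) (hρ x hx').le) (sub_nonneg.2 ?_)
  have h1 : 1 + -H * ρ x ^ ((1 : ℝ) / 8) ≤ R x := by linarith [(abs_le.1 (hR x hx')).1]
  exact mul_le_mul h1 (hY x hx).le
    (mul_nonneg hA (gronwallWeight_pos _ hr₀ (hρ x hx')).le) (hR_pos x hx').le

end Comparison

section PartialDerivatives

open scoped ContDiff

variable {f : ℝ × ℝ → ℝ} {D : Set (ℝ × ℝ)}

theorem hasDerivAt_fst_of_differentiableAt {z : ℝ × ℝ} (hf : DifferentiableAt ℝ f z) :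
    HasDerivAt (fun x => f (x, z.2)) (fderiv ℝ f z (1, 0)) z.1 :=
  hf.hasFDerivAt.comp_hasDerivAt z.1 ((hasDerivAt_id z.1).prodMk (hasDerivAt_const z.1 z.2))

theorem hasDerivAt_snd_of_differentiableAt {z : ℝ × ℝ} (hf : DifferentiableAt ℝ f z) :
    HasDerivAt (fun y => f (z.1, y)) (fderiv ℝ f z (0, 1)) z.2 :=
  hf.hasFDerivAt.comp_hasDerivAt z.2 ((hasDerivAt_const z.2 z.1).prodMk (hasDerivAt_id z.2))

theorem pdu_eq_fderiv {z : ℝ × ℝ} (hf : DifferentiableAt ℝ f z) :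
    pdu f z = fderiv ℝ f z (1, 0) :=
  (hasDerivAt_fst_of_differentiableAt hf).deriv

theorem pdv_eq_fderiv {z : ℝ × ℝ} (hf : DifferentiableAt ℝ f z) :
    pdv f z = fderiv ℝ f z (0, 1) :=
  (hasDerivAt_snd_of_differentiableAt hf).deriv

theorem hasDerivAt_pdu {z : ℝ × ℝ} (hf : DifferentiableAt ℝ f z) :
    HasDerivAt (fun x => f (x, z.2)) (pdu f z) z.1 :=
  (hasDerivAt_fst_of_differentiableAt hf).differentiableAt.hasDerivAt

theorem hasDerivAt_pdv {z : ℝ × ℝ} (hf : DifferentiableAt ℝ f z) :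
    HasDerivAt (fun y => f (z.1, y)) (pdv f z) z.2 :=
  (hasDerivAt_snd_of_differentiableAt hf).differentiableAt.hasDerivAt

theorem differentiableAt_of_contDiffOn (hf : ContDiffOn ℝ ∞ f D) (hD : IsOpen D) {z : ℝ × ℝ}
    (hz : z ∈ D) : DifferentiableAt ℝ f z :=
  (hf.contDiffAt (hD.mem_nhds hz)).differentiableAt (by simp)

theorem contDiffOn_fderiv_apply (hf : ContDiffOn ℝ ∞ f D) (hD : IsOpen D) (w : ℝ × ℝ) :
    ContDiffOn ℝ ∞ (fun z => fderiv ℝ f z w) D :=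
  (hf.fderiv_of_isOpen hD (by simp)).clm_apply contDiffOn_const

theorem contDiffOn_pdu (hf : ContDiffOn ℝ ∞ f D) (hD : IsOpen D) :
    ContDiffOn ℝ ∞ (pdu f) D :=
  (contDiffOn_fderiv_apply hf hD (1, 0)).congr fun _ hz =>
    pdu_eq_fderiv (differentiableAt_of_contDiffOn hf hD hz)

theorem contDiffOn_pdv (hf : ContDiffOn ℝ ∞ f D) (hD : IsOpen D) :
    ContDiffOn ℝ ∞ (pdv f) D :=
  (contDiffOn_fderiv_apply hf hD (0, 1)).congr fun _ hz =>
    pdv_eq_fderiv (differentiableAt_of_contDiffOn hf hD hz)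

theorem pdv_pdu_eq_pdu_pdv (hf : ContDiffOn ℝ ∞ f D) (hD : IsOpen D) {z : ℝ × ℝ} (hz : z ∈ D) :
    pdv (pdu f) z = pdu (pdv f) z := by
  have hnhds := hD.mem_nhds hz
  have hu : pdu f =ᶠ[nhds z] fun w => fderiv ℝ f w (1, 0) := by
    filter_upwards [hnhds] with w hw
      using pdu_eq_fderiv (differentiableAt_of_contDiffOn hf hD hw)
  have hv : pdv f =ᶠ[nhds z] fun w => fderiv ℝ f w (0, 1) := by
    filter_upwards [hnhds] with w hw
      using pdv_eq_fderiv (differentiableAt_of_contDiffOn hf hD hw)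
  have hd : DifferentiableAt ℝ (fderiv ℝ f) z :=
    ((hf.fderiv_of_isOpen (m := ∞) hD (by simp)).contDiffAt hnhds).differentiableAt (by simp)
  have happ : ∀ w w' : ℝ × ℝ,
      fderiv ℝ (fun y => fderiv ℝ f y w) z w' = fderiv ℝ (fderiv ℝ f) z w' w := by
    intro w w'
    rw [fderiv_clm_apply hd (differentiableAt_const w)]
    simp
  rw [pdv_eq_fderiv (differentiableAt_of_contDiffOn (contDiffOn_pdu hf hD) hD hz),
    pdu_eq_fderiv (differentiableAt_of_contDiffOn (contDiffOn_pdv hf hD) hD hz),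
    hu.fderiv_eq, hv.fderiv_eq, happ, happ]
  exact ((hf.contDiffAt hnhds).isSymmSndFDerivAt
    (by
      rw [minSmoothness_of_isRCLikeNormedField]
      exact WithTop.coe_le_coe.2 le_top)).eq _ _

end PartialDerivatives

theorem weighted_gronwall_scalar_field_bounds
    (Λ : ℝ) (hΛ : 0 < Λ) (D : Set (ℝ × ℝ)) (hD : IsOpen D)
    (r Ω φ : ℝ × ℝ → ℝ)
    (hrC : ContDiffOn ℝ (⊤ : ℕ∞) r D) (hΩC : ContDiffOn ℝ (⊤ : ℕ∞) Ω D) (hφC : ContDiffOn ℝ (⊤ : ℕ∞) φ D)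
    (hrpos : ∀ z ∈ D, 0 < r z) (hΩpos : ∀ z ∈ D, 0 < Ω z)
    (hsys1 : ∀ z ∈ D, pdu (fun w => r w * pdv r w) z = -(1/4) * Ω z ^ 2 * (1 - Λ * r z ^ 2))
    (hsys2 : ∀ z ∈ D, pdv (fun w => r w * pdu r w) z = -(1/4) * Ω z ^ 2 * (1 - Λ * r z ^ 2))
    (hsys3 : ∀ z ∈ D, pdu (pdv (fun w => Real.log (Ω w ^ 2))) z =
      -2 * pdu φ z * pdv φ z + (1/2) * (r z)⁻¹ ^ 2 * Ω z ^ 2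
        + 2 * (r z)⁻¹ ^ 2 * pdu r z * pdv r z)
    (hsys4 : ∀ z ∈ D, r z * pdu (pdv φ) z = -(pdu r z) * pdv φ z - pdv r z * pdu φ z)
    (hsys5 : ∀ z ∈ D, pdu (fun w => (Ω w ^ 2)⁻¹ * pdu r w) z
      = -(r z) * (Ω z ^ 2)⁻¹ * (pdu φ z) ^ 2)
    (hsys6 : ∀ z ∈ D, pdv (fun w => (Ω w ^ 2)⁻¹ * pdv r w) z
      = -(r z) * (Ω z ^ 2)⁻¹ * (pdv φ z) ^ 2)
    (qt : ℝ × ℝ) (hqt : qt ∈ D) (r₀ : ℝ) (hr₀ : 0 < r₀)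
    (J : Set (ℝ × ℝ))
    (hJdef : J = {z | z ∈ D ∧ z.1 ≤ qt.1 ∧ z.2 ≤ qt.2 ∧ 0 < r z ∧ r z ≤ r₀})
    (hmono : ∀ z ∈ J, pdu r z < 0 ∧ pdv r z < 0)
    (hconnu : ∀ z ∈ J, ∃ a ≤ z.1, r (a, z.2) = r₀ ∧
      ∀ t ∈ Set.Icc a z.1, (t, z.2) ∈ J)
    (hconnv : ∀ z ∈ J, ∃ a ≤ z.2, r (z.1, a) = r₀ ∧
      ∀ t ∈ Set.Icc a z.2, (z.1, t) ∈ J)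
    (C₁ C₂ H : ℝ) (hC₁ : 0 < C₁) (hC₂ : 0 < C₂) (hH : 0 ≤ H)
    (hHint : ∫ s in (0 : ℝ)..r₀, H * s ^ ((1 : ℝ) / 8 - 1) ≤ Real.log 2)
    (hratio : ∀ z ∈ J,
      |C₁ * pdv r z / (C₂ * pdu r z) - 1| ≤ H * r z ^ ((1 : ℝ) / 8) ∧
      |C₂ * pdu r z / (C₁ * pdv r z) - 1| ≤ H * r z ^ ((1 : ℝ) / 8)) :
    (∀ Ψt : ℝ,
      (∀ z ∈ J, r z = r₀ →
        |C₂ * (r z * pdu φ z)| ≤ Ψt ∧ |C₁ * (r z * pdv φ z)| ≤ Ψt) →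
      ∀ z ∈ J, C₁ * (r z ^ 2 * |pdv φ z|) ≤ 2 * r₀ * Ψt ∧
        C₂ * (r z ^ 2 * |pdu φ z|) ≤ 2 * r₀ * Ψt) ∧
    ((∀ z ∈ J, 0 < pdu φ z ∧ 0 < pdv φ z) →
      ∀ Ψl : ℝ,
      (∀ z ∈ J, r z = r₀ →
        Ψl ≤ C₂ * (r z * pdu φ z) ∧ Ψl ≤ C₁ * (r z * pdv φ z)) →
      ∀ z ∈ J, r₀ * Ψl / 2 ≤ C₁ * (r z ^ 2 * pdv φ z) ∧
        r₀ * Ψl / 2 ≤ C₂ * (r z ^ 2 * pdu φ z)) := by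
  obtain ⟨hJD, hJr⟩ : J ⊆ D ∧ ∀ z ∈ J, 0 < r z :=
    ⟨fun z hz => (hJdef ▸ hz : z ∈ {z | z ∈ D ∧ _}).1, fun z hz =>
      (hJdef ▸ hz : z ∈ {z | z ∈ D ∧ _}).2.2.2.1⟩
  have hdr : ∀ z ∈ J, DifferentiableAt ℝ r z := fun z hz =>
    differentiableAt_of_contDiffOn hrC hD (hJD hz)
  have hφu := contDiffOn_pdu hφC hD
  have hφv := contDiffOn_pdv hφC hD
  have hP : PastConnected J r qt r₀ :=
    { le_top := fun z hz => by rw [hJdef] at hz; exact hz.2.2.2.2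
      le_corner := fun z hz => by rw [hJdef] at hz; exact ⟨hz.2.1, hz.2.2.1⟩
      eventually_mem := fun z hz hlt => by
        filter_upwards [hD.mem_nhds (hJD hz),
          (hdr z hz).continuousAt.eventually_lt continuousAt_const hlt] with w hw hwr h1 h2
        rw [hJdef]
        exact ⟨hw, h1, h2, hrpos w hw, hwr.le⟩
      strictAnti_fst := fun v a b hab hseg =>
        strictAntiOn_of_deriv_neg (f := fun x => r (x, v)) (convex_Icc a b)
          (fun x hx => (hasDerivAt_pdu (hdr _ (hseg x hx))).continuousAt.continuousWithinAt)
          (fun x hx => (hmono _ (hseg x (interior_subset hx))).1)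
          ⟨le_rfl, hab.le⟩ ⟨hab.le, le_rfl⟩ hab
      strictAnti_snd := fun u a b hab hseg =>
        strictAntiOn_of_deriv_neg (f := fun y => r (u, y)) (convex_Icc a b)
          (fun y hy => (hasDerivAt_pdv (hdr _ (hseg y hy))).continuousAt.continuousWithinAt)
          (fun y hy => (hmono _ (hseg y (interior_subset hy))).2)
          ⟨le_rfl, hab.le⟩ ⟨hab.le, le_rfl⟩ hab
      exists_fst := hconnu
      exists_snd := hconnv }
  have hlog : 8 * H * r₀ ^ ((1 : ℝ) / 8) ≤ Real.log 2 := by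
    rw [intervalIntegral.integral_const_mul, integral_rpow (Or.inl (by norm_num))] at hHint
    norm_num at hHint ⊢
    linarith
  have hrc : ContinuousOn r J := hrC.continuousOn.mono hJD
  have hXc : ContinuousOn (fun z => C₂ * (r z * pdu φ z)) J :=
    (hrc.mul (hφu.continuousOn.mono hJD)).const_smul C₂
  have hYc : ContinuousOn (fun z => C₁ * (r z * pdv φ z)) J :=
    (hrc.mul (hφv.continuousOn.mono hJD)).const_smul C₁
  have hWc : ∀ A κ : ℝ, ContinuousOn (fun z => A * gronwallWeight κ r₀ (r z)) J := fun A κ =>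
    ((continuousOn_gronwallWeight κ r₀).comp hrc hJr).const_smul A
  have hdX : ∀ u v, (u, v) ∈ J → HasDerivAt (fun y => C₂ * (r (u, y) * pdu φ (u, y)))
      (-pdv r (u, v) / r (u, v) * (C₂ * pdu r (u, v) / (C₁ * pdv r (u, v)) *
        (C₁ * (r (u, v) * pdv φ (u, v))))) v := by
    intro u v hz
    have h1 := ((hasDerivAt_pdv (hdr _ hz)).mul
      (hasDerivAt_pdv (differentiableAt_of_contDiffOn hφu hD (hJD hz)))).const_mul C₂
    refine h1.congr_deriv ?_
    have h2 := hsys4 _ (hJD hz)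
    rw [← pdv_pdu_eq_pdu_pdv hφC hD (hJD hz)] at h2
    have h3 := (hJr _ hz).ne'
    have h4 := (hmono _ hz).2.ne
    simp only
    rw [h2]
    field_simp
    ring
  have hdY : ∀ u v, (u, v) ∈ J → HasDerivAt (fun x => C₁ * (r (x, v) * pdv φ (x, v)))
      (-pdu r (u, v) / r (u, v) * (C₁ * pdv r (u, v) / (C₂ * pdu r (u, v)) *
        (C₂ * (r (u, v) * pdu φ (u, v))))) u := by
    intro u v hz
    have h1 := ((hasDerivAt_pdu (hdr _ hz)).mul
      (hasDerivAt_pdu (differentiableAt_of_contDiffOn hφv hD (hJD hz)))).const_mul C₁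
    refine h1.congr_deriv ?_
    have h2 := hsys4 _ (hJD hz)
    have h3 := (hJr _ hz).ne'
    have h4 := (hmono _ hz).1.ne
    simp only
    rw [h2]
    field_simp
    ring
  constructor
  · intro Ψt hΨ z hz
    obtain ⟨a, haz, har, haseg⟩ := hconnu z hz
    have hΨ0 : 0 ≤ Ψt := (abs_nonneg _).trans (hΨ _ (haseg a ⟨le_rfl, haz⟩) har).1
    have key : ∀ A, Ψt < A → C₁ * (r z ^ 2 * |pdv φ z|) ≤ 2 * r₀ * A ∧
        C₂ * (r z ^ 2 * |pdu φ z|) ≤ 2 * r₀ * A := by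
      intro A hA
      have h := hP.forall_pos hrc
        (f := fun z => A * gronwallWeight H r₀ (r z) - |C₂ * (r z * pdu φ z)|)
        (g := fun z => A * gronwallWeight H r₀ (r z) - |C₁ * (r z * pdv φ z)|)
        ((hWc A H).sub hXc.abs) ((hWc A H).sub hYc.abs)
        (fun t b c hbc hb hseg hgood => sub_pos.2 <|
          abs_lt_gronwallWeight_of_hasDerivAt hbc (fun y hy => hJr _ (hseg y hy))
            (fun y hy => (hmono _ (hseg y hy)).2)
            (fun y hy => hasDerivAt_pdv (hdr _ (hseg y hy)))
            (fun y hy => hdX t y (hseg y hy)) (fun y hy => (hratio _ (hseg y hy)).2)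
            (fun y hy => sub_pos.1 (hgood y hy).2)
            (by
              have := (hΨ _ (hseg b ⟨le_rfl, hbc⟩) hb).1
              rw [hb] at this ⊢
              rw [gronwallWeight_self H hr₀]
              linarith))
        (fun w a c hac ha hseg hgood => sub_pos.2 <|
          abs_lt_gronwallWeight_of_hasDerivAt hac (fun x hx => hJr _ (hseg x hx))
            (fun x hx => (hmono _ (hseg x hx)).1)
            (fun x hx => hasDerivAt_pdu (hdr _ (hseg x hx)))
            (fun x hx => hdY x w (hseg x hx)) (fun x hx => (hratio _ (hseg x hx)).1)
            (fun x hx => sub_pos.1 (hgood x hx).1)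
            (by
              have := (hΨ _ (hseg a ⟨le_rfl, hac⟩) ha).2
              rw [ha] at this ⊢
              rw [gronwallWeight_self H hr₀]
              linarith)) z hz
      have hr := hJr z hz
      have hW : r z * (A * gronwallWeight H r₀ (r z)) ≤ 2 * r₀ * A := by
        have hA0 : 0 ≤ A := hΨ0.trans hA.le
        calc r z * (A * gronwallWeight H r₀ (r z)) ≤ r z * (A * (2 * r₀ / r z)) := by
              gcongr
              exact gronwallWeight_le hr₀ hr hH hlog
          _ = 2 * r₀ * A := by field_simp
      have hX := mul_le_mul_of_nonneg_left (sub_pos.1 h.1).le hr.le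
      have hY := mul_le_mul_of_nonneg_left (sub_pos.1 h.2).le hr.le
      rw [abs_mul, abs_mul, abs_of_pos hC₂, abs_of_pos hr] at hX
      rw [abs_mul, abs_mul, abs_of_pos hC₁, abs_of_pos hr] at hY
      constructor <;> linarith
    have hr2 : 0 < 2 * r₀ := by linarith
    constructor <;> rw [← div_le_iff₀' hr2] <;>
      refine le_of_forall_gt_imp_ge_of_dense fun A hA => ?_ <;> rw [div_le_iff₀' hr2]
    exacts [(key A hA).1, (key A hA).2]
  · intro hφpos Ψl hΨ z hz
    have key : ∀ A, A < Ψl → r₀ * A / 2 ≤ C₁ * (r z ^ 2 * pdv φ z) ∧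
        r₀ * A / 2 ≤ C₂ * (r z ^ 2 * pdu φ z) := by
      intro A hA
      have hr := hJr z hz
      have hφz := hφpos z hz
      rcases le_total A 0 with hA0 | hA0
      · have hle : r₀ * A / 2 ≤ 0 := by nlinarith
        exact ⟨hle.trans (by have := hφz.2; positivity), hle.trans (by have := hφz.1; positivity)⟩
      have h := hP.forall_pos hrc
        (f := fun z => C₂ * (r z * pdu φ z) - A * gronwallWeight (-H) r₀ (r z))
        (g := fun z => C₁ * (r z * pdv φ z) - A * gronwallWeight (-H) r₀ (r z))
        (hXc.sub (hWc A (-H))) (hYc.sub (hWc A (-H)))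
        (fun t b c hbc hb hseg hgood => sub_pos.2 <|
          gronwallWeight_lt_of_hasDerivAt hbc hr₀ hA0 (fun y hy => hJr _ (hseg y hy))
            (fun y hy => (hmono _ (hseg y hy)).2)
            (fun y hy => hasDerivAt_pdv (hdr _ (hseg y hy)))
            (fun y hy => hdX t y (hseg y hy)) (fun y hy => (hratio _ (hseg y hy)).2)
            (fun y hy => div_pos_of_neg_of_neg
              (mul_neg_of_pos_of_neg hC₂ (hmono _ (hseg y hy)).1)
              (mul_neg_of_pos_of_neg hC₁ (hmono _ (hseg y hy)).2))
            (fun y hy => sub_pos.1 (hgood y hy).2)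
            (by
              have := (hΨ _ (hseg b ⟨le_rfl, hbc⟩) hb).1
              rw [hb] at this ⊢
              rw [gronwallWeight_self (-H) hr₀]
              linarith))
        (fun w a c hac ha hseg hgood => sub_pos.2 <|
          gronwallWeight_lt_of_hasDerivAt hac hr₀ hA0 (fun x hx => hJr _ (hseg x hx))
            (fun x hx => (hmono _ (hseg x hx)).1)
            (fun x hx => hasDerivAt_pdu (hdr _ (hseg x hx)))
            (fun x hx => hdY x w (hseg x hx)) (fun x hx => (hratio _ (hseg x hx)).1)
            (fun x hx => div_pos_of_neg_of_neg
              (mul_neg_of_pos_of_neg hC₁ (hmono _ (hseg x hx)).2)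
              (mul_neg_of_pos_of_neg hC₂ (hmono _ (hseg x hx)).1))
            (fun x hx => sub_pos.1 (hgood x hx).1)
            (by
              have := (hΨ _ (hseg a ⟨le_rfl, hac⟩) ha).2
              rw [ha] at this ⊢
              rw [gronwallWeight_self (-H) hr₀]
              linarith)) z hz
      have hW : r₀ * A / 2 ≤ r z * (A * gronwallWeight (-H) r₀ (r z)) := by
        calc r₀ * A / 2 = r z * (A * (r₀ / (2 * r z))) := by field_simp
          _ ≤ r z * (A * gronwallWeight (-H) r₀ (r z)) := by
              gcongr
              exact le_gronwallWeight_neg hr₀ hr hH hlog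
      have hX := mul_le_mul_of_nonneg_left (sub_pos.1 h.1).le hr.le
      have hY := mul_le_mul_of_nonneg_left (sub_pos.1 h.2).le hr.le
      constructor <;> linarith
    have hr2 : 0 < r₀ / 2 := by linarith
    constructor <;> rw [mul_div_right_comm, ← le_div_iff₀' hr2] <;>
      refine le_of_forall_lt_imp_le_of_dense fun A hA => ?_ <;>
      rw [le_div_iff₀' hr2, ← mul_div_right_comm]
    exacts [(key A hA).1, (key A hA).2]
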